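/- For nonzero complex numbers λ₁, λ₂ with λ₁ ≠ λ₂, the 4×4 matrix with rows (1,1,0,0), (λ₁,λ₂,λ₁,λ₂), (λ₁²,λ₂²,2λ₁²,2λ₂²), (λ₁³,λ₂³,3λ₁³,3λ₂³) is invertible. -/

import Mathlib

theorem stmt3 (l1 l2 : ℂ) (h1 : l1 ≠ 0) (h2 : l2 ≠ 0) (h12 : l1 ≠ l2) :
    IsUnit (!![(1 : ℂ), 1, 0, 0;
               l1, l2, l1, l2;
               l1^2, l2^2, 2*l1^2, 2*l2^2;
               l1^3, l2^3, 3*l1^3, 3*l2^3]) := by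
  rw [Matrix.isUnit_iff_isUnit_det, isUnit_iff_ne_zero]
  have key : (!![(1 : ℂ), 1, 0, 0;
               l1, l2, l1, l2;
               l1^2, l2^2, 2*l1^2, 2*l2^2;
               l1^3, l2^3, 3*l1^3, 3*l2^3]).det = -(l1 * l2 * (l1 - l2)^4) := by
    simp [Matrix.det_succ_row_zero, Fin.sum_univ_succ, Fin.succAbove]
    ring
  rw [key]
  exact neg_ne_zero.mpr (mul_ne_zero (mul_ne_zero h1 h2) (pow_ne_zero 4 (sub_ne_zero.mpr h12)))
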